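/- arXiv:2008.08110 — 2 statements merged into one kernel-verified Lean document; each statement's English description precedes it below -/
import Mathlib

section
/- A numerical semigroup S ≠ ℕ is almost symmetric if and only if it satisfies the following property: whenever x and y are gaps of S with x + y > F(S), the number x + y − F(S) is also a gap of S. -/
open scoped Classical

/-- A numerical set: a subset of ℕ containing 0 with finite complement. -/
def NumericalSet (H : Set ℕ) : Prop := 0 ∈ H ∧ Hᶜ.Finite

/-- A numerical semigroup: a numerical set closed under addition. -/
def NumericalSemigroup (S : Set ℕ) : Prop :=
  NumericalSet S ∧ ∀ a ∈ S, ∀ b ∈ S, a + b ∈ S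

/-- Frobenius number: the largest gap. -/
noncomputable def frob (H : Set ℕ) : ℕ := sSup Hᶜ

/-- Genus: the number of gaps. -/
noncomputable def genus (H : Set ℕ) : ℕ := Hᶜ.ncard

/-- Multiplicity: the smallest nonzero element. -/
noncomputable def mult (H : Set ℕ) : ℕ := sInf {x | x ∈ H ∧ x ≠ 0}

/-- The T-set of a numerical set.  (With truncated subtraction, every `x ≥ frob H`
satisfies `frob H - x = 0`, matching the convention that `F(H) - x` computed in ℤ
is nonpositive, hence not a nonzero element of `H`.) -/
def Tset (H : Set ℕ) : Set ℕ := {x | frob H - x ∉ H ∨ frob H - x = 0}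

/-- The associated numerical semigroup of a numerical set. -/
def A (H : Set ℕ) : Set ℕ := {x | ∀ h ∈ H, x + h ∈ H}

/-- `A*`-operation on numerical sets. -/
def Astar (H : Set ℕ) : Set ℕ := {a | ∀ h ∈ H, h ≠ 0 → a + h ∈ H}

/-- Pseudo-Frobenius numbers of a numerical set. -/
def PF (H : Set ℕ) : Set ℕ := {a | a ∉ H ∧ ∀ h ∈ H, h ≠ 0 → a + h ∈ H}

/-- Type of a numerical set. -/
noncomputable def typ (H : Set ℕ) : ℕ := (PF H).ncard

/-- Almost symmetric: `t(S) = 2 g(S) - F(S)`. -/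
def AlmostSymmetric (S : Set ℕ) : Prop :=
  (typ S : ℤ) = 2 * (genus S : ℤ) - (frob S : ℤ)

/-- An ordinary numerical set: `{0} ∪ {x : x > F(H)}`. -/
def Ordinary (H : Set ℕ) : Prop := H = insert 0 {x : ℕ | frob H < x}

theorem frob_notMem {S : Set ℕ} (hS : NumericalSet S) (hne : S ≠ Set.univ) : frob S ∉ S :=
  Nat.sSup_mem (Set.nonempty_compl.2 hne) hS.2.bddAbove

theorem le_frob {S : Set ℕ} (hS : NumericalSet S) {x : ℕ} (hx : x ∉ S) : x ≤ frob S :=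
  le_csSup hS.2.bddAbove hx

/-- Gaps `x` of `H` such that `F(H) - x` is a gap as well. -/
def symmetricGaps (H : Set ℕ) : Set ℕ := {x | x ∉ H ∧ x < frob H ∧ frob H - x ∉ H}

theorem frob_sub_notMem {S : Set ℕ} (hS : NumericalSemigroup S) (hne : S ≠ Set.univ) {x : ℕ}
    (hx : x ∈ S) (hle : x ≤ frob S) : frob S - x ∉ S := fun h ↦
  frob_notMem hS.1 hne (Nat.add_sub_cancel' hle ▸ hS.2 _ hx _ h)

theorem symmetricGaps_finite {S : Set ℕ} (hS : NumericalSet S) : (symmetricGaps S).Finite :=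
  hS.2.subset fun _ hx ↦ hx.1

theorem ncard_symmetricGaps {S : Set ℕ} (hS : NumericalSemigroup S) (hne : S ≠ Set.univ) :
    ((symmetricGaps S).ncard : ℤ) + 1 = 2 * genus S - frob S := by
  set F := frob S with hF
  have hFS : F ∉ S := frob_notMem hS.1 hne
  set N := S ∩ Set.Iic F with hN
  have hNfin : N.Finite := (Set.finite_Iic F).inter_of_right S
  have hN_card : ((fun x ↦ F - x) '' N).ncard = N.ncard :=
    Set.InjOn.ncard_image fun a ha b hb hab ↦ by
      have h₁ : a ≤ F := ha.2
      have h₂ : b ≤ F := hb.2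
      omega
  have hgaps : (symmetricGaps S).ncard + N.ncard = genus S := by
    rw [← hN_card, ← Set.ncard_union_eq _ (symmetricGaps_finite hS.1) (hNfin.image _), genus]
    · congr 1
      ext x
      constructor
      · rintro (hx | ⟨s, hs, rfl⟩)
        · exact hx.1
        · exact frob_sub_notMem hS hne hs.1 hs.2
      · intro hx
        have hle : x ≤ F := le_frob hS.1 hx
        by_cases h : F - x ∈ S
        · exact Or.inr ⟨F - x, ⟨h, Nat.sub_le _ _⟩, Nat.sub_sub_self hle⟩
        · refine Or.inl ⟨hx, lt_of_le_of_ne hle ?_, h⟩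
          intro heq
          exact h (by rw [heq, Nat.sub_self]; exact hS.1.1)
    · rw [Set.disjoint_left]
      rintro _ hx ⟨s, hs, rfl⟩
      exact hx.2.2 (by simpa only [← hF, Nat.sub_sub_self hs.2] using hs.1)
  have htotal : genus S + N.ncard = F + 1 := by
    rw [genus, ← Set.ncard_union_eq _ hS.1.2 hNfin]
    · have : Sᶜ ∪ N = Set.Iic F := by
        ext x
        by_cases hx : x ∈ S
        · simp [hN, hx]
        · simp [hx, hF, le_frob hS.1 hx]
      rw [this, ← Finset.coe_Iic, Set.ncard_coe_finset, Nat.card_Iic]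
    · exact Set.disjoint_left.2 fun x hx hx' ↦ hx hx'.1
  omega

theorem PF_subset {S : Set ℕ} (hS : NumericalSemigroup S) (hne : S ≠ Set.univ) :
    PF S ⊆ insert (frob S) (symmetricGaps S) := by
  rintro x ⟨hx, hadd⟩
  have hle := le_frob hS.1 hx
  refine hle.eq_or_lt.imp id fun hlt ↦ ⟨hx, hlt, fun h ↦ ?_⟩
  have := hadd _ h (by omega)
  rw [Nat.add_sub_cancel' hle] at this
  exact frob_notMem hS.1 hne this

theorem frob_mem_PF {S : Set ℕ} (hS : NumericalSet S) (hne : S ≠ Set.univ) : frob S ∈ PF S := by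
  refine ⟨frob_notMem hS hne, fun h _ h0 ↦ ?_⟩
  by_contra hgap
  have := le_frob hS hgap
  omega

theorem almostSymmetric_iff_symmetricGaps_subset {S : Set ℕ} (hS : NumericalSemigroup S)
    (hne : S ≠ Set.univ) : AlmostSymmetric S ↔ symmetricGaps S ⊆ PF S := by
  have hfin := symmetricGaps_finite hS.1
  have hcard : (insert (frob S) (symmetricGaps S)).ncard = (symmetricGaps S).ncard + 1 :=
    Set.ncard_insert_of_notMem (fun h ↦ lt_irrefl _ h.2.1) hfin
  have hcount := ncard_symmetricGaps hS hne
  have hsub := PF_subset hS hne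
  rw [AlmostSymmetric, ← hcount, typ]
  constructor
  · intro h
    rw [Set.eq_of_subset_of_ncard_le hsub (by omega) (hfin.insert _)]
    exact Set.subset_insert _ _
  · intro h
    rw [hsub.antisymm (Set.insert_subset (frob_mem_PF hS.1 hne) h), hcard]
    push_cast
    rfl

theorem stmt_3 (S : Set ℕ) (hS : NumericalSemigroup S) (hne : S ≠ Set.univ) :
    AlmostSymmetric S ↔
      ∀ x y : ℕ, x ∉ S → y ∉ S → frob S < x + y → x + y - frob S ∉ S := by
  rw [almostSymmetric_iff_symmetricGaps_subset hS hne]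
  constructor
  · intro hsub x y hx hy hlt hmem
    have hle := le_frob hS.1 hx
    have hy_eq : frob S - x + (x + y - frob S) = y := by omega
    have hx' : frob S - x ∉ S := fun h ↦ hy (hy_eq ▸ hS.2 _ h _ hmem)
    have hx_ne : x ≠ 0 := fun h ↦ hx (h ▸ hS.1.1)
    have hL : frob S - x ∈ symmetricGaps S :=
      ⟨hx', by omega, by rwa [Nat.sub_sub_self hle]⟩
    exact hy (hy_eq ▸ (hsub hL).2 _ hmem (by omega))
  · rintro hgap x ⟨hx, hlt, hx'⟩
    refine ⟨hx, fun h hh h0 ↦ ?_⟩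
    by_contra hxh
    have := hgap _ _ hx' hxh (by omega)
    rw [show frob S - x + (x + h) - frob S = h by omega] at this
    exact this hh
end

section
/- Let α and g be positive integers with g ≥ 3α − 1. Then the map S ↦ T(S) is a bijection from the set of numerical semigroups with genus g and type g − α onto the set of numerical sets T satisfying g(A(T)) = α. -/
open scoped Classical

theorem frob_notMem_s7 {H : Set ℕ} (hfin : Hᶜ.Finite) (hne : Hᶜ.Nonempty) : frob H ∉ H :=
  Nat.sSup_mem hne hfin.bddAbove

theorem mem_of_frob_lt {H : Set ℕ} (hfin : Hᶜ.Finite) {x : ℕ} (hx : frob H < x) : x ∈ H := by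
  by_contra hxH
  exact hx.not_ge (le_csSup hfin.bddAbove hxH)

theorem frob_eq {H : Set ℕ} {F : ℕ} (hF : F ∉ H) (hlt : ∀ x, F < x → x ∈ H) : frob H = F :=
  IsGreatest.csSup_eq ⟨hF, fun x hx => by
    by_contra hFx
    exact hx (hlt x (by omega))⟩

theorem compl_nonempty_of_genus_pos {H : Set ℕ} (hH : 0 < genus H) : Hᶜ.Nonempty :=
  Set.nonempty_of_ncard_ne_zero (Nat.pos_iff_ne_zero.mp hH)

theorem mem_Tset {S : Set ℕ} {x : ℕ} : x ∈ Tset S ↔ frob S - x ∉ S ∨ frob S - x = 0 := Iff.rfl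

theorem numericalSet_Tset {S : Set ℕ} (hfin : Sᶜ.Finite) (hne : Sᶜ.Nonempty) :
    NumericalSet (Tset S) := by
  refine ⟨Or.inl (by simpa using frob_notMem_s7 hfin hne), (Set.finite_Iio (frob S)).subset ?_⟩
  intro x hx
  rw [Set.mem_compl_iff, mem_Tset] at hx
  rw [Set.mem_Iio]
  omega

/-- The gaps of `T(S)` are the reflections of the nonzero elements of `S` below `F(S)`. -/
theorem genus_Tset_add_genus {S : Set ℕ} (hS : NumericalSet S) (hne : Sᶜ.Nonempty) :
    genus (Tset S) + genus S = frob S := by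
  have hT := numericalSet_Tset hS.2 hne
  have hlt : ∀ x ∈ (Tset S)ᶜ, x < frob S ∧ frob S - x ∈ S := by
    intro x hx
    rw [Set.mem_compl_iff, mem_Tset] at hx
    push Not at hx
    exact ⟨by omega, hx.1⟩
  have himage : ((fun x => frob S - x) '' (Tset S)ᶜ).ncard = genus (Tset S) := by
    refine Set.InjOn.ncard_image fun x hx y hy hxy => ?_
    have := (hlt x hx).1
    have := (hlt y hy).1
    omega
  have hdisj : Disjoint ((fun x => frob S - x) '' (Tset S)ᶜ) Sᶜ := by
    rw [Set.disjoint_left]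
    rintro _ ⟨x, hx, rfl⟩ hxS
    exact hxS (hlt x hx).2
  have hunion : (fun x => frob S - x) '' (Tset S)ᶜ ∪ Sᶜ = ↑(Finset.Icc 1 (frob S)) := by
    ext y
    simp only [Set.mem_union, Set.mem_image, Finset.coe_Icc, Set.mem_Icc]
    constructor
    · rintro (⟨x, hx, rfl⟩ | hy)
      · have := (hlt x hx).1
        omega
      · refine ⟨Nat.one_le_iff_ne_zero.mpr fun h0 => hy (h0 ▸ hS.1), ?_⟩
        by_contra hFy
        exact hy (mem_of_frob_lt hS.2 (by omega))
    · rintro ⟨h1, hF⟩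
      by_cases hy : y ∈ S
      · refine Or.inl ⟨frob S - y, ?_, by omega⟩
        rw [Set.mem_compl_iff, mem_Tset, Nat.sub_sub_self hF]
        push Not
        exact ⟨hy, by omega⟩
      · exact Or.inr hy
  have hcard := Set.ncard_union_eq hdisj (hT.2.image _) hS.2
  rw [hunion, Set.ncard_coe_finset, Nat.card_Icc, himage] at hcard
  change frob S + 1 - 1 = genus (Tset S) + genus S at hcard
  omega

theorem A_Tset {S : Set ℕ} (hS : NumericalSemigroup S) : A (Tset S) = S ∪ PF S := by
  have hfin := hS.1.2
  ext x
  constructor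
  · intro hx
    by_cases hxS : x ∈ S
    · exact Or.inl hxS
    refine Or.inr ⟨hxS, fun h hh h0 => ?_⟩
    by_contra hxh
    have hle : x + h ≤ frob S := by
      by_contra hlt
      exact hxh (mem_of_frob_lt hfin (by omega))
    have hmem := hx (frob S - (x + h)) (Or.inl (by rwa [Nat.sub_sub_self hle]))
    rw [mem_Tset, show frob S - (x + (frob S - (x + h))) = h by omega] at hmem
    exact hmem.elim (· hh) h0
  · intro hx t ht
    rw [mem_Tset]
    by_contra hy
    push Not at hy
    have hadd : x + (frob S - (x + t)) ∈ S :=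
      hx.elim (fun hxS => hS.2 _ hxS _ hy.1) (fun hxP => hxP.2 _ hy.1 hy.2)
    rw [show x + (frob S - (x + t)) = frob S - t by omega] at hadd
    exact ht.elim (· hadd) (by omega)

theorem genus_A_Tset_add_typ {S : Set ℕ} (hS : NumericalSemigroup S) :
    genus (A (Tset S)) + typ S = genus S := by
  rw [A_Tset hS, genus, Set.compl_union, ← Set.sdiff_eq]
  exact Set.ncard_sdiff_add_ncard_of_subset (fun x hx => hx.1) hS.1.2

theorem genus_le_genus_A {T : Set ℕ} (h0 : 0 ∈ T) (hA : (A T)ᶜ.Finite) :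
    genus T ≤ genus (A T) :=
  Set.ncard_le_ncard (Set.compl_subset_compl.mpr fun x hx => by simpa using hx 0 h0) hA

theorem frob_lt_genus_A_add_genus {T : Set ℕ} (hT : Tᶜ.Finite) (hne : Tᶜ.Nonempty)
    (hA : (A T)ᶜ.Finite) : frob T < genus (A T) + genus T := by
  have hsub : (↑(Finset.Iic (frob T)) : Set ℕ) ⊆
      (A T)ᶜ ∪ (fun x => frob T - x) '' Tᶜ := by
    intro a ha
    rw [Finset.coe_Iic, Set.mem_Iic] at ha
    by_cases haA : a ∈ A T
    · refine Or.inr ⟨frob T - a, fun hmem => frob_notMem_s7 hT hne ?_, by simp only; omega⟩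
      simpa [Nat.add_sub_cancel' ha] using haA _ hmem
    · exact Or.inl haA
  have h1 := Set.ncard_le_ncard hsub (hA.union (hT.image _))
  rw [Set.ncard_coe_finset, Nat.card_Iic] at h1
  have h2 := Set.ncard_union_le (A T)ᶜ ((fun x => frob T - x) '' Tᶜ)
  have h3 := Set.ncard_image_le (f := fun x => frob T - x) hT
  unfold genus
  omega

/-- The reflection of the complement of `T` through `F`, with `0` adjoined; this inverts `Tset`
on the sets of Frobenius number `F`. -/
def reflect (F : ℕ) (T : Set ℕ) : Set ℕ := {s | s = 0 ∨ F < s ∨ F - s ∉ T}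

theorem mem_reflect {F s : ℕ} {T : Set ℕ} : s ∈ reflect F T ↔ s = 0 ∨ F < s ∨ F - s ∉ T := Iff.rfl

theorem reflect_Tset {S : Set ℕ} (hS : NumericalSet S) :
    reflect (frob S) (Tset S) = S := by
  ext s
  rw [mem_reflect, mem_Tset]
  rcases Nat.eq_zero_or_pos s with rfl | hs
  · simp [hS.1]
  rcases lt_or_ge (frob S) s with hlt | hle
  · simp [hlt, mem_of_frob_lt hS.2 hlt]
  · rw [Nat.sub_sub_self hle]
    simp [hs.ne', not_lt.mpr hle]

theorem frob_reflect {F : ℕ} {T : Set ℕ} (h0 : 0 ∈ T) (hF : 0 < F) : frob (reflect F T) = F :=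
  frob_eq (by simp [mem_reflect, h0, hF.ne']) fun _ hx => Or.inr (Or.inl hx)

theorem numericalSet_reflect (F : ℕ) (T : Set ℕ) : NumericalSet (reflect F T) := by
  refine ⟨Or.inl rfl, (Set.finite_Iic F).subset fun x hx => ?_⟩
  rw [Set.mem_Iic]
  by_contra hlt
  exact hx (Or.inr (Or.inl (by omega)))

theorem numericalSemigroup_reflect {F : ℕ} {T : Set ℕ} (hT : Tᶜ.Finite) (hF : 2 * frob T < F) :
    NumericalSemigroup (reflect F T) := by
  have hlow : ∀ s ∈ reflect F T, s = 0 ∨ F - frob T ≤ s := by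
    rintro s (rfl | hs | hs)
    · exact Or.inl rfl
    · exact Or.inr (by omega)
    · refine Or.inr ?_
      by_contra hlt
      exact hs (mem_of_frob_lt hT (by omega))
  refine ⟨numericalSet_reflect F T, fun a ha b hb => ?_⟩
  rcases hlow a ha with rfl | ha'
  · simpa using hb
  rcases hlow b hb with rfl | hb'
  · simpa using ha
  exact Or.inr (Or.inl (by omega))

theorem Tset_reflect {F : ℕ} {T : Set ℕ} (hT : NumericalSet T) (hF : frob T < F) :
    Tset (reflect F T) = T := by
  ext x
  rw [mem_Tset, frob_reflect hT.1 (by omega), mem_reflect]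
  rcases lt_or_ge x F with hlt | hle
  · rw [Nat.sub_sub_self hlt.le]
    have h1 : F - x ≠ 0 := by omega
    have h2 : ¬ F < F - x := by omega
    simp [h1, h2]
  · simp [Nat.sub_eq_zero_of_le hle, mem_of_frob_lt hT.2 (hF.trans_le hle)]

theorem stmt_7 (α g : ℕ) (hα : 0 < α) (hg : 0 < g) (h : 3 * (α : ℤ) - 1 ≤ (g : ℤ)) :
    Set.BijOn Tset
      {S : Set ℕ | NumericalSemigroup S ∧ genus S = g ∧ (typ S : ℤ) = (g : ℤ) - (α : ℤ)}
      {T : Set ℕ | NumericalSet T ∧ genus (A T) = α} := by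
  refine ⟨?_, ?_, ?_⟩
  · rintro S ⟨hS, hgS, htS⟩
    have hne : Sᶜ.Nonempty := compl_nonempty_of_genus_pos (by omega)
    have := genus_A_Tset_add_typ hS
    exact ⟨numericalSet_Tset hS.1.2 hne, by omega⟩
  · rintro S ⟨hS, hgS, -⟩ S' ⟨hS', hgS', -⟩ hSS'
    have h1 := genus_Tset_add_genus hS.1 (compl_nonempty_of_genus_pos (by omega))
    have h2 := genus_Tset_add_genus hS'.1 (compl_nonempty_of_genus_pos (by omega))
    have hfrob : frob S = frob S' := by rw [← h1, ← h2, hSS', hgS, hgS']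
    rw [← reflect_Tset hS.1, ← reflect_Tset hS'.1, hSS', hfrob]
  · rintro T ⟨hT, hAT⟩
    have hAfin : (A T)ᶜ.Finite := Set.finite_of_ncard_pos (show 0 < genus (A T) by omega)
    have hne : Tᶜ.Nonempty := by
      rw [Set.nonempty_compl]
      rintro rfl
      have : A Set.univ = Set.univ := Set.eq_univ_of_forall fun x h _ => Set.mem_univ (x + h)
      simp [this, genus] at hAT
      omega
    have hle := genus_le_genus_A hT.1 hAfin
    have hlt := frob_lt_genus_A_add_genus hT.2 hne hAfin
    have hF : 2 * frob T < g + genus T := by omega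
    have hS := numericalSemigroup_reflect hT.2 hF
    have hTS : Tset (reflect (g + genus T) T) = T := Tset_reflect hT (by omega)
    have hfrob : frob (reflect (g + genus T) T) = g + genus T := frob_reflect hT.1 (by omega)
    have hneS : (reflect (g + genus T) T)ᶜ.Nonempty :=
      ⟨g + genus T, by simp [mem_reflect, hT.1, hg.ne']⟩
    have hgenus := genus_Tset_add_genus hS.1 hneS
    have htyp := genus_A_Tset_add_typ hS
    rw [hTS] at hgenus htyp
    exact ⟨_, ⟨hS, by omega, by omega⟩, hTS⟩
end
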